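/- On ℝ⁴ with canonical coordinates (q₁,q₂,p₁,p₂) define the polynomial functions H = p₁p₂ − 3q₁² − q₂, B = p₁²/4 − q₁p₁p₂ + q₂p₂² + 2q₁(q₁² − q₂), X = p₂² − 2q₁ and Y = p₁/2 + p₂³ − 3p₂q₁. Then with respect to the canonical Poisson bracket the following algebra of first integrals holds identically: {H,B} = 0, {H,X} = 0, {H,Y} = 0, {B,X} = 2Y, {B,Y} = 3X² + H, and {X,Y} = −1. In particular, the Hamiltonian system with quadratic Hamiltonian H on the plane is superintegrable, with additional integrals X and Y polynomial of degree two and three in momenta. -/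

import Mathlib

/-- The canonical Poisson bracket on `ℝ⁴` with coordinates `(q₁,q₂,p₁,p₂)`. -/
noncomputable def poissonBracket (f g : ℝ → ℝ → ℝ → ℝ → ℝ) (q₁ q₂ p₁ p₂ : ℝ) : ℝ :=
    deriv (fun x => f x q₂ p₁ p₂) q₁ * deriv (fun y => g q₁ q₂ y p₂) p₁
  + deriv (fun x => f q₁ x p₁ p₂) q₂ * deriv (fun y => g q₁ q₂ p₁ y) p₂
  - deriv (fun y => f q₁ q₂ y p₂) p₁ * deriv (fun x => g x q₂ p₁ p₂) q₁
  - deriv (fun y => f q₁ q₂ p₁ y) p₂ * deriv (fun x => g q₁ x p₁ p₂) q₂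

/-- Hamiltonian `H = p₁p₂ − 3q₁² − q₂`. -/
noncomputable def HFun (q₁ q₂ p₁ p₂ : ℝ) : ℝ := p₁ * p₂ - 3 * q₁ ^ 2 - q₂

/-- Second integral `B`. -/
noncomputable def BFun (q₁ q₂ p₁ p₂ : ℝ) : ℝ :=
  p₁ ^ 2 / 4 - q₁ * p₁ * p₂ + q₂ * p₂ ^ 2 + 2 * q₁ * (q₁ ^ 2 - q₂)

/-- Additional integral `X = p₂² − 2q₁`, quadratic in momenta. -/
noncomputable def XFun (q₁ q₂ p₁ p₂ : ℝ) : ℝ := p₂ ^ 2 - 2 * q₁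

/-- Additional integral `Y = p₁/2 + p₂³ − 3p₂q₁`, cubic in momenta. -/
noncomputable def YFun (q₁ q₂ p₁ p₂ : ℝ) : ℝ := p₁ / 2 + p₂ ^ 3 - 3 * p₂ * q₁

theorem deriv_cubic (a b c d x : ℝ) :
    deriv (fun t => a * t ^ 3 + b * t ^ 2 + c * t + d) x = 3 * a * x ^ 2 + 2 * b * x + c := by
  have h := ((((hasDerivAt_pow 3 x).const_mul a).add ((hasDerivAt_pow 2 x).const_mul b)).add
    ((hasDerivAt_id' x).const_mul c)).add_const d
  refine h.deriv.trans ?_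
  push_cast
  ring

theorem deriv_eq_of_eq_cubic {f : ℝ → ℝ} (a b c d x : ℝ)
    (hf : ∀ t, f t = a * t ^ 3 + b * t ^ 2 + c * t + d) :
    deriv f x = 3 * a * x ^ 2 + 2 * b * x + c := by
  rw [funext hf, deriv_cubic]

section PartialDerivatives

variable (q₁ q₂ p₁ p₂ : ℝ)

theorem deriv_HFun_q₁ : deriv (fun t => HFun t q₂ p₁ p₂) q₁ = -6 * q₁ := by
  rw [deriv_eq_of_eq_cubic 0 (-3) 0 (p₁ * p₂ - q₂) q₁
    (fun t => by simp only [HFun]; ring)]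
  ring

theorem deriv_HFun_q₂ : deriv (fun t => HFun q₁ t p₁ p₂) q₂ = -1 := by
  rw [deriv_eq_of_eq_cubic 0 0 (-1) (p₁ * p₂ - 3 * q₁ ^ 2) q₂
    (fun t => by simp only [HFun]; ring)]
  ring

theorem deriv_HFun_p₁ : deriv (fun t => HFun q₁ q₂ t p₂) p₁ = p₂ := by
  rw [deriv_eq_of_eq_cubic 0 0 p₂ (-3 * q₁ ^ 2 - q₂) p₁
    (fun t => by simp only [HFun]; ring)]
  ring

theorem deriv_HFun_p₂ : deriv (fun t => HFun q₁ q₂ p₁ t) p₂ = p₁ := by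
  rw [deriv_eq_of_eq_cubic 0 0 p₁ (-3 * q₁ ^ 2 - q₂) p₂
    (fun t => by simp only [HFun]; ring)]
  ring

theorem deriv_BFun_q₁ : deriv (fun t => BFun t q₂ p₁ p₂) q₁ = -p₁ * p₂ + 6 * q₁ ^ 2 - 2 * q₂ := by
  rw [deriv_eq_of_eq_cubic 2 0 (-p₁ * p₂ - 2 * q₂) (p₁ ^ 2 / 4 + q₂ * p₂ ^ 2) q₁
    (fun t => by simp only [BFun]; ring)]
  ring

theorem deriv_BFun_q₂ : deriv (fun t => BFun q₁ t p₁ p₂) q₂ = p₂ ^ 2 - 2 * q₁ := by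
  rw [deriv_eq_of_eq_cubic 0 0 (p₂ ^ 2 - 2 * q₁) (p₁ ^ 2 / 4 - q₁ * p₁ * p₂ + 2 * q₁ ^ 3) q₂
    (fun t => by simp only [BFun]; ring)]
  ring

theorem deriv_BFun_p₁ : deriv (fun t => BFun q₁ q₂ t p₂) p₁ = p₁ / 2 - q₁ * p₂ := by
  rw [deriv_eq_of_eq_cubic 0 (1 / 4) (-q₁ * p₂) (q₂ * p₂ ^ 2 + 2 * q₁ * (q₁ ^ 2 - q₂)) p₁
    (fun t => by simp only [BFun]; ring)]
  ring

theorem deriv_BFun_p₂ : deriv (fun t => BFun q₁ q₂ p₁ t) p₂ = -q₁ * p₁ + 2 * q₂ * p₂ := by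
  rw [deriv_eq_of_eq_cubic 0 q₂ (-q₁ * p₁) (p₁ ^ 2 / 4 + 2 * q₁ * (q₁ ^ 2 - q₂)) p₂
    (fun t => by simp only [BFun]; ring)]
  ring

theorem deriv_XFun_q₁ : deriv (fun t => XFun t q₂ p₁ p₂) q₁ = -2 := by
  rw [deriv_eq_of_eq_cubic 0 0 (-2) (p₂ ^ 2) q₁
    (fun t => by simp only [XFun]; ring)]
  ring

theorem deriv_XFun_q₂ : deriv (fun t => XFun q₁ t p₁ p₂) q₂ = 0 := by
  rw [deriv_eq_of_eq_cubic 0 0 0 (p₂ ^ 2 - 2 * q₁) q₂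
    (fun t => by simp only [XFun]; ring)]
  ring

theorem deriv_XFun_p₁ : deriv (fun t => XFun q₁ q₂ t p₂) p₁ = 0 := by
  rw [deriv_eq_of_eq_cubic 0 0 0 (p₂ ^ 2 - 2 * q₁) p₁
    (fun t => by simp only [XFun]; ring)]
  ring

theorem deriv_XFun_p₂ : deriv (fun t => XFun q₁ q₂ p₁ t) p₂ = 2 * p₂ := by
  rw [deriv_eq_of_eq_cubic 0 1 0 (-2 * q₁) p₂
    (fun t => by simp only [XFun]; ring)]
  ring

theorem deriv_YFun_q₁ : deriv (fun t => YFun t q₂ p₁ p₂) q₁ = -3 * p₂ := by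
  rw [deriv_eq_of_eq_cubic 0 0 (-3 * p₂) (p₁ / 2 + p₂ ^ 3) q₁
    (fun t => by simp only [YFun]; ring)]
  ring

theorem deriv_YFun_q₂ : deriv (fun t => YFun q₁ t p₁ p₂) q₂ = 0 := by
  rw [deriv_eq_of_eq_cubic 0 0 0 (p₁ / 2 + p₂ ^ 3 - 3 * p₂ * q₁) q₂
    (fun t => by simp only [YFun]; ring)]
  ring

theorem deriv_YFun_p₁ : deriv (fun t => YFun q₁ q₂ t p₂) p₁ = 1 / 2 := by
  rw [deriv_eq_of_eq_cubic 0 0 (1 / 2) (p₂ ^ 3 - 3 * p₂ * q₁) p₁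
    (fun t => by simp only [YFun]; ring)]
  ring

theorem deriv_YFun_p₂ : deriv (fun t => YFun q₁ q₂ p₁ t) p₂ = 3 * p₂ ^ 2 - 3 * q₁ := by
  rw [deriv_eq_of_eq_cubic 1 0 (-3 * q₁) (p₁ / 2) p₂
    (fun t => by simp only [YFun]; ring)]
  ring

end PartialDerivatives

/-- The algebra of first integrals of the superintegrable system on the plane:
`{H,B} = 0`, `{H,X} = 0`, `{H,Y} = 0`, `{B,X} = 2Y`, `{B,Y} = 3X² + H`,
`{X,Y} = −1`, identically on `ℝ⁴`. -/
theorem superintegrable_algebra (q₁ q₂ p₁ p₂ : ℝ) :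
    poissonBracket HFun BFun q₁ q₂ p₁ p₂ = 0 ∧
    poissonBracket HFun XFun q₁ q₂ p₁ p₂ = 0 ∧
    poissonBracket HFun YFun q₁ q₂ p₁ p₂ = 0 ∧
    poissonBracket BFun XFun q₁ q₂ p₁ p₂ = 2 * YFun q₁ q₂ p₁ p₂ ∧
    poissonBracket BFun YFun q₁ q₂ p₁ p₂ =
      3 * (XFun q₁ q₂ p₁ p₂) ^ 2 + HFun q₁ q₂ p₁ p₂ ∧
    poissonBracket XFun YFun q₁ q₂ p₁ p₂ = -1 := by
  simp only [poissonBracket,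
    deriv_HFun_q₁, deriv_HFun_q₂, deriv_HFun_p₁, deriv_HFun_p₂,
    deriv_BFun_q₁, deriv_BFun_q₂, deriv_BFun_p₁, deriv_BFun_p₂,
    deriv_XFun_q₁, deriv_XFun_q₂, deriv_XFun_p₁, deriv_XFun_p₂,
    deriv_YFun_q₁, deriv_YFun_q₂, deriv_YFun_p₁, deriv_YFun_p₂]
  simp only [HFun, XFun, YFun]
  refine ⟨?_, ?_, ?_, ?_, ?_, ?_⟩ <;> ring
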